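/- The set of all commutative nil-varieties of semigroups is definable in the lattice Com. Moreover, a commutative semigroup variety is a nil-variety if and only if every atom of Com contained in it equals the variety ZM of null semigroups. -/

import Mathlib

open FirstOrder

/-! ### Words, identities, and commutative semigroup varieties -/

/-- Semigroup words over the countable alphabet `ℕ`. -/
abbrev SGWord : Type := FreeSemigroup ℕ

/-- A semigroup identity `u = v` is a pair of words. -/
abbrev SGId : Type := SGWord × SGWord

/-- The one-letter word consisting of the letter `n`. -/
def ltr (n : ℕ) : SGWord := FreeSemigroup.of n

/-- `wpow w n` is the word `w^n` (for `n ≥ 1`; by convention `wpow w 0 = w`). -/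
def wpow (w : SGWord) : ℕ → SGWord
  | 0 => w
  | 1 => w
  | n + 2 => wpow w (n + 1) * w

/-- The letter `n` occurs in the word `w`. -/
def OccursIn (n : ℕ) (w : SGWord) : Prop := n = w.head ∨ n ∈ w.tail

/-- A semigroup `S` satisfies the identity `i.1 = i.2` if all evaluations of the two
words in `S` coincide. -/
def SGSatisfies (S : Type) [Semigroup S] (i : SGId) : Prop :=
  ∀ f : ℕ → S, FreeSemigroup.lift f i.1 = FreeSemigroup.lift f i.2

/-- A bundled (nonempty) commutative semigroup. -/
structure ComSG where
  carrier : Type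
  [str : CommSemigroup carrier]
  [instNonempty : Nonempty carrier]

attribute [instance] ComSG.str ComSG.instNonempty

/-- The class of commutative semigroups satisfying every identity in `E`. -/
def modelsOf (E : Set SGId) : Set ComSG := {S | ∀ i ∈ E, SGSatisfies S.carrier i}

/-- The set of identities holding in every member of the class `K`. -/
def theoryOfClass (K : Set ComSG) : Set SGId := {i | ∀ S ∈ K, SGSatisfies S.carrier i}

theorem subset_theoryOfClass_modelsOf (E : Set SGId) : E ⊆ theoryOfClass (modelsOf E) :=
  fun i hi S hS => hS i hi

theorem theoryOfClass_antitone {K K' : Set ComSG} (h : K ⊆ K') :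
    theoryOfClass K' ⊆ theoryOfClass K := fun _ hi S hS => hi S (h hS)

theorem modelsOf_antitone {E E' : Set SGId} (h : E ⊆ E') : modelsOf E' ⊆ modelsOf E :=
  fun _ hS i hi => hS i (h hi)

/-- A variety of commutative semigroups, identified with its (equationally closed)
equational theory.  Varieties are ordered by inclusion of the corresponding classes
of semigroups, i.e. by *reverse* inclusion of theories. -/
structure ComVariety where
  theory : Set SGId
  closed : theoryOfClass (modelsOf theory) = theory

theorem ComVariety.ext' {V W : ComVariety} (h : V.theory = W.theory) : V = W := by
  cases V; cases W; cases h; rfl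

instance : PartialOrder ComVariety where
  le V W := W.theory ⊆ V.theory
  le_refl V := subset_rfl
  le_trans U V W h1 h2 := fun i hi => h1 (h2 hi)
  le_antisymm V W h1 h2 := ComVariety.ext' (subset_antisymm h2 h1)

instance : SupSet ComVariety where
  sSup s :=
    { theory := ⋂ V ∈ s, V.theory
      closed := by
        apply subset_antisymm
        · intro i hi
          refine Set.mem_iInter₂.2 fun V hV => ?_
          have h1 : (⋂ V ∈ s, ComVariety.theory V) ⊆ V.theory := Set.biInter_subset_of_mem hV
          have h2 := theoryOfClass_antitone (modelsOf_antitone h1)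
          rw [V.closed] at h2
          exact h2 hi
        · exact subset_theoryOfClass_modelsOf _ }

/-- The lattice **Com** of all commutative semigroup varieties. -/
instance : CompleteLattice ComVariety :=
  completeLatticeOfSup ComVariety fun s => by
    constructor
    · intro V hV i hi
      exact Set.mem_iInter₂.1 hi V hV
    · intro W hW i hi
      exact Set.mem_iInter₂.2 fun V hV => hW hV hi

/-- The variety of commutative semigroups given by the identity system `E`. -/
def comVar (E : Set SGId) : ComVariety where
  theory := theoryOfClass (modelsOf E)
  closed := by
    apply subset_antisymm
    · exact theoryOfClass_antitone fun S hS i hi => hi S hS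
    · exact subset_theoryOfClass_modelsOf _

/-! ### The first-order language of lattices and definability -/

/-- The first-order language of lattices: two binary function symbols (`true` for the
join `∨` and `false` for the meet `∧`) and nothing else. -/
def latticeLang : Language where
  Functions := fun n => match n with | 2 => Bool | _ => Empty
  Relations := fun _ => Empty

instance latticeLangStructure (L : Type*) [Lattice L] : latticeLang.Structure L where
  funMap {n} f x :=
    match n, f with
    | 2, b => bif b then x 0 ⊔ x 1 else x 0 ⊓ x 1
    | 0, f => f.elim
    | 1, f => f.elim
    | (_ + 3), f => f.elim
  RelMap {n} r _ := r.elim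

/-- A subset `A` of a lattice `L` is definable in `L` if there is a first-order formula
`φ(x)` with one free variable in the language of the lattice operations `∨` and `∧`
such that for every `a ∈ L`, `φ(a)` holds in `L` if and only if `a ∈ A`. -/
def LatDefinable (L : Type*) [Lattice L] (A : Set L) : Prop :=
  ∃ φ : latticeLang.Formula (Fin 1), ∀ a : L, (φ.Realize fun _ => a) ↔ a ∈ A

/-! ### Named varieties -/

/-- The commutativity identity `xy = yx`. -/
def commId : SGId := (ltr 0 * ltr 1, ltr 1 * ltr 0)

/-- The pair of identities abbreviated by the symbolic identity `w = 0`, namely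
`wx = w` and `xw = w`, where `x` is the letter `n` (assumed not to occur in `w`). -/
def zeroId (w : SGWord) (n : ℕ) : Set SGId := {(w * ltr n, w), (ltr n * w, w)}

/-- `A n = var{xⁿy = y, xy = yx}`, the variety of Abelian groups of exponent dividing `n`. -/
def Avar (n : ℕ) : ComVariety := comVar {(wpow (ltr 0) n * ltr 1, ltr 1), commId}

/-- `SL = var{x² = x, xy = yx}`, the variety of semilattices. -/
def SLvar : ComVariety := comVar {(wpow (ltr 0) 2, ltr 0), commId}

/-- `ZM = var{xy = 0}` (within **Com**), the variety of null semigroups. -/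
def ZMvar : ComVariety := comVar ({commId} ∪ zeroId (ltr 0 * ltr 1) 2)

/-- `T = var{x = y}`, the trivial variety. -/
def Tvar : ComVariety := comVar {(ltr 0, ltr 1)}

/-- `COM`, the variety of all commutative semigroups. -/
def COMvar : ComVariety := comVar {commId}

/-- `C m = var{xᵐ = xᵐ⁺¹, xy = yx}` (the variety generated by the cyclic monoid
`⟨a ∣ aᵐ = aᵐ⁺¹⟩`), with the convention `C 0 = T`. -/
def Cvar : ℕ → ComVariety
  | 0 => Tvar
  | m + 1 => comVar {(wpow (ltr 0) (m + 1), wpow (ltr 0) (m + 2)), commId}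

/-- `D m = var{xᵐ = 0, xy = yx}`. -/
def Dvar (m : ℕ) : ComVariety := comVar ({commId} ∪ zeroId (wpow (ltr 0) m) 1)

/-- The word `x₁x₂⋯x_k` (in the letters `0, 1, …, k-1`), for `k ≥ 1`. -/
def chainWord : ℕ → SGWord
  | 0 => ltr 0
  | 1 => ltr 0
  | k + 2 => chainWord (k + 1) * ltr (k + 1)

/-- `N k = var{x² = x₁x₂⋯x_k = 0, xy = yx}`. -/
def Nvar (k : ℕ) : ComVariety :=
  comVar ({commId} ∪ zeroId (wpow (ltr 0) 2) 1 ∪ zeroId (chainWord k) k)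

/-- `N_ω = var{x² = 0, xy = yx}`. -/
def Nomegavar : ComVariety := comVar ({commId} ∪ zeroId (wpow (ltr 0) 2) 1)

/-- `N₃ᶜ = var{xyz = 0, xy = yx}`. -/
def N3cvar : ComVariety := comVar ({commId} ∪ zeroId (ltr 0 * ltr 1 * ltr 2) 3)

/-! ### Semantic notions -/

/-- A semigroup `S` belongs to the variety `V` if it satisfies every identity of `V`. -/
def VMem (S : Type) [Semigroup S] (V : ComVariety) : Prop :=
  ∀ i ∈ V.theory, SGSatisfies S i

/-- `spow a n` is the power `aⁿ` in a semigroup (for `n ≥ 1`; by convention `spow a 0 = a`). -/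
def spow {S : Type} [Semigroup S] (a : S) : ℕ → S
  | 0 => a
  | 1 => a
  | n + 2 => spow a (n + 1) * a

/-- A semigroup is a group. -/
def IsGroupSG (S : Type) [Semigroup S] : Prop :=
  ∃ e : S, (∀ a, e * a = a ∧ a * e = a) ∧ ∀ a, ∃ b, a * b = e ∧ b * a = e

/-- A semigroup is periodic: every element generates a finite cyclic subsemigroup. -/
def IsPeriodicSG (S : Type) [Semigroup S] : Prop :=
  ∀ a : S, ∃ i j : ℕ, 1 ≤ i ∧ i < j ∧ spow a i = spow a j

/-- A semigroup is a nil-semigroup: it has a zero element and every element has a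
power equal to zero. -/
def IsNilSG (S : Type) [Semigroup S] : Prop :=
  ∃ z : S, (∀ a, z * a = z ∧ a * z = z) ∧ ∀ a, ∃ n, 1 ≤ n ∧ spow a n = z

/-- A variety all of whose members are groups. -/
def IsGroupVariety (V : ComVariety) : Prop := ∀ S ∈ modelsOf V.theory, IsGroupSG S.carrier

/-- A variety all of whose members are periodic semigroups. -/
def IsPeriodicVariety (V : ComVariety) : Prop := ∀ S ∈ modelsOf V.theory, IsPeriodicSG S.carrier

/-- A nil-variety: a variety all of whose members are nil-semigroups. -/
def IsNilVariety (V : ComVariety) : Prop := ∀ S ∈ modelsOf V.theory, IsNilSG S.carrier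

/-- A combinatorial variety: all groups in it are trivial. -/
def IsCombinatorial (V : ComVariety) : Prop :=
  ∀ S ∈ modelsOf V.theory, IsGroupSG S.carrier → ∀ a b : S.carrier, a = b

/-- `K` is the variety generated by the semigroup `M` (with explicit semigroup
structure `inst`): the smallest variety containing `M`. -/
def GeneratedBy (M : Type) (inst : Semigroup M) (K : ComVariety) : Prop :=
  IsLeast {W : ComVariety | ∀ i ∈ W.theory, @SGSatisfies M inst i} K

/-- A neutral element of a lattice. -/
def IsNeutralElt {α : Type*} [Lattice α] (x : α) : Prop :=
  ∀ y z, (x ⊔ y) ⊓ (y ⊔ z) ⊓ (z ⊔ x) = (x ⊓ y) ⊔ (y ⊓ z) ⊔ (z ⊓ x)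

/-- A chain variety: a variety whose lattice of subvarieties is a chain. -/
def IsChainVariety (V : ComVariety) : Prop :=
  ∀ W₁ W₂ : ComVariety, W₁ ≤ V → W₂ ≤ V → W₁ ≤ W₂ ∨ W₂ ≤ W₁

/-- A variety is 0-reduced in **Com** if it is given within `COM` by 0-reduced
identities (identities of the form `w = 0`) only. -/
def IsZeroReduced (V : ComVariety) : Prop :=
  ∃ P : Set (SGWord × ℕ), (∀ p ∈ P, ¬ OccursIn p.2 p.1) ∧
    V = comVar (⋃ p ∈ P, zeroId p.1 p.2)

/-- `ZR V`: the least variety 0-reduced in **Com** that contains `V`. -/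
def ZRv (V : ComVariety) : ComVariety := sInf {W : ComVariety | IsZeroReduced W ∧ V ≤ W}

/-! ### Evaluating words in commutative semigroups -/

/-- The multiset of letters of a word. -/
def SGWord.letters (u : SGWord) : Multiset ℕ := u.head ::ₘ (u.tail : Multiset ℕ)

theorem SGWord.letters_of (x : ℕ) : SGWord.letters (FreeSemigroup.of x) = {x} := rfl

theorem SGWord.letters_mul (u v : SGWord) :
    SGWord.letters (u * v) = SGWord.letters u + SGWord.letters v := by
  simp [SGWord.letters, FreeSemigroup.head_mul, FreeSemigroup.tail_mul, ← Multiset.coe_add,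
    ← Multiset.cons_coe, Multiset.cons_swap]

/-- The word `x ^ (k + 1)` in the letter `x`. -/
def letterPow (x k : ℕ) : SGWord := ⟨x, List.replicate k x⟩

theorem letters_letterPow (x k : ℕ) :
    SGWord.letters (letterPow x k) = Multiset.replicate (k + 1) x := by
  simp [SGWord.letters, letterPow, Multiset.replicate_succ, Multiset.coe_replicate]

theorem SGWord.card_letters_pos (u : SGWord) : 0 < Multiset.card (SGWord.letters u) := by
  simp [SGWord.letters]

theorem lift_eq_prod {M : Type*} [CommMonoid M] (f : ℕ → M) (u : SGWord) :
    FreeSemigroup.lift f u = ((SGWord.letters u).map f).prod := by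
  induction u using FreeSemigroup.recOnMul with
  | ih1 x => simp [SGWord.letters_of]
  | ih2 x y hx hy => rw [map_mul, hx, hy, SGWord.letters_mul, Multiset.map_add, Multiset.prod_add]

theorem coe_lift_eq_prod {S : Type*} [CommSemigroup S] (f : ℕ → S) (u : SGWord) :
    ((FreeSemigroup.lift f u : S) : WithOne S) =
      ((SGWord.letters u).map fun x => (f x : WithOne S)).prod := by
  induction u using FreeSemigroup.recOnMul with
  | ih1 x => simp [SGWord.letters_of]
  | ih2 x y hx hy =>
    rw [map_mul, WithOne.coe_mul, hx, hy, SGWord.letters_mul, Multiset.map_add, Multiset.prod_add]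

theorem sgSatisfies_iff_prod {S : Type} [CommSemigroup S] (i : SGId) :
    SGSatisfies S i ↔ ∀ f : ℕ → S,
      ((SGWord.letters i.1).map fun x => (f x : WithOne S)).prod =
        ((SGWord.letters i.2).map fun x => (f x : WithOne S)).prod := by
  refine forall_congr' fun f => ?_
  rw [← coe_lift_eq_prod, ← coe_lift_eq_prod, WithOne.coe_inj]

theorem sgSatisfies_iff_prod_monoid {M : Type} [CommMonoid M] (i : SGId) :
    SGSatisfies M i ↔ ∀ f : ℕ → M,
      ((SGWord.letters i.1).map f).prod = ((SGWord.letters i.2).map f).prod := by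
  refine forall_congr' fun f => ?_
  rw [lift_eq_prod, lift_eq_prod]

theorem Multiset.prod_map_ite_eq {ι M : Type*} [DecidableEq ι] [CommMonoid M] (s : Multiset ι)
    (x : ι) (g h : M) :
    (s.map fun y => if y = x then g else h).prod =
      g ^ s.count x * h ^ (Multiset.card s - s.count x) := by
  induction s using Multiset.induction_on with
  | empty => simp
  | cons a s ih =>
    have hle := Multiset.count_le_card x s
    by_cases hax : a = x
    · subst hax
      simp only [Multiset.map_cons, if_true, Multiset.prod_cons, ih, Multiset.count_cons_self,
        Multiset.card_cons, Nat.add_sub_add_right, pow_succ']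
      rw [mul_assoc]
    · have h1 : Multiset.card s + 1 - s.count x = (Multiset.card s - s.count x) + 1 := by omega
      simp only [Multiset.map_cons, if_neg hax, Multiset.prod_cons, ih,
        Multiset.count_cons_of_ne (Ne.symm hax), Multiset.card_cons, h1, pow_succ']
      rw [mul_left_comm]

theorem Multiset.prod_map_eq_prod_of_subset {ι M : Type*} [DecidableEq ι] [CommMonoid M]
    {s : Multiset ι} (f : ι → M) {F : Finset ι} (hF : s.toFinset ⊆ F) :
    (s.map f).prod = ∏ x ∈ F, f x ^ s.count x := by
  rw [Finset.prod_multiset_map_count]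
  refine Finset.prod_subset hF fun x _ hx => ?_
  rw [Multiset.count_eq_zero_of_notMem (by simpa using hx), pow_zero]

theorem WithOne.exists_coe_eq_pow {S : Type*} [CommSemigroup S] (s : S) {k : ℕ} (hk : 1 ≤ k) :
    ∃ t : S, (t : WithOne S) = (s : WithOne S) ^ k := by
  induction k, hk using Nat.le_induction with
  | base => exact ⟨s, by simp⟩
  | succ k _ ih =>
    obtain ⟨t, ht⟩ := ih
    exact ⟨t * s, by rw [WithOne.coe_mul, ht, pow_succ]⟩

theorem coe_spow {S : Type} [CommSemigroup S] (s : S) (k : ℕ) :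
    ((spow s (k + 1) : S) : WithOne S) = (s : WithOne S) ^ (k + 1) := by
  induction k with
  | zero => simp [spow]
  | succ k ih => rw [spow, WithOne.coe_mul, ih, ← pow_succ]

/-! ### Elementary facts on varieties -/

theorem ComVariety.mem_theory_iff (V : ComVariety) (i : SGId) :
    i ∈ V.theory ↔ ∀ S ∈ modelsOf V.theory, SGSatisfies S.carrier i :=
  ⟨fun hi _ hS => hS i hi, fun h => V.closed ▸ h⟩

theorem ComVariety.modelsOf_theory_mono {V W : ComVariety} (h : V ≤ W) {S : ComSG}
    (hS : S ∈ modelsOf V.theory) : S ∈ modelsOf W.theory :=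
  modelsOf_antitone h hS

theorem mem_modelsOf_comVar {E : Set SGId} {S : ComSG} :
    S ∈ modelsOf (comVar E).theory ↔ S ∈ modelsOf E :=
  ⟨fun h => modelsOf_antitone (subset_theoryOfClass_modelsOf E) h, fun h _ hi => hi S h⟩

theorem ComVariety.eq_bot_of_subsingleton {V : ComVariety}
    (h : ∀ S ∈ modelsOf V.theory, ∀ s t : S.carrier, s = t) : V = ⊥ :=
  le_bot_iff.1 fun i _ => (V.mem_theory_iff i).2 fun S hS _ => h S hS _ _

/-- The variety generated by a commutative semigroup. -/
def varGeneratedBy (S : ComSG) : ComVariety where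
  theory := {i | SGSatisfies S.carrier i}
  closed := subset_antisymm (fun _ hi => hi S fun _ hj => hj) (subset_theoryOfClass_modelsOf _)

theorem varGeneratedBy_le_comVar {S : ComSG} {E : Set SGId} (h : S ∈ modelsOf E) :
    varGeneratedBy S ≤ comVar E := fun _ hi => hi S h

/-- A variety all of whose members satisfy `x ^ (n + 1) = x` for some `n ≥ 1`. -/
def IsRegularVariety (V : ComVariety) : Prop :=
  ∃ n, 1 ≤ n ∧ ∀ S ∈ modelsOf V.theory, ∀ s : S.carrier, (s : WithOne S.carrier) ^ (n + 1) = s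

theorem IsRegularVariety.mono {V W : ComVariety} (h : V ≤ W) :
    IsRegularVariety W → IsRegularVariety V := fun ⟨n, hn, H⟩ =>
  ⟨n, hn, fun S hS => H S (ComVariety.modelsOf_theory_mono h hS)⟩

theorem IsNilVariety.mono {V W : ComVariety} (h : V ≤ W) (hW : IsNilVariety W) :
    IsNilVariety V := fun S hS => hW S (ComVariety.modelsOf_theory_mono h hS)

theorem pow_mul_add_one_of_pow_succ_eq {M : Type*} [Monoid M] {a : M} {n : ℕ}
    (h : a ^ (n + 1) = a) (k : ℕ) : a ^ (n * k + 1) = a := by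
  induction k with
  | zero => simp
  | succ k ih => rw [show n * (k + 1) + 1 = (n * k + 1) + n by ring, pow_add, ih, ← pow_succ', h]

theorem IsNilVariety.eq_bot_of_isRegularVariety {V : ComVariety} (hV : IsNilVariety V)
    (hr : IsRegularVariety V) : V = ⊥ := by
  obtain ⟨n, hn, H⟩ := hr
  refine ComVariety.eq_bot_of_subsingleton fun S hS => ?_
  obtain ⟨z, hz, hnil⟩ := hV S hS
  suffices h : ∀ s : S.carrier, s = z from fun s t => (h s).trans (h t).symm
  intro s
  obtain ⟨k, hk, hsk⟩ := hnil s
  obtain ⟨k, rfl⟩ := Nat.exists_eq_add_of_le' hk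
  have hz' : ∀ t : WithOne S.carrier, (z : WithOne S.carrier) * t = z := by
    intro t
    rcases eq_or_ne t 1 with rfl | ht
    · rw [mul_one]
    · obtain ⟨t, rfl⟩ := WithOne.ne_one_iff_exists.1 ht
      rw [← WithOne.coe_mul, (hz t).1]
  have h1 := pow_mul_add_one_of_pow_succ_eq (H S hS s) (k + 1)
  have h2 : n * (k + 1) + 1 = (k + 1) + ((n - 1) * (k + 1) + 1) := by
    obtain ⟨n, rfl⟩ := Nat.exists_eq_add_of_le' hn
    simp; ring
  rw [h2, pow_add, ← coe_spow, hsk, hz'] at h1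
  exact (WithOne.coe_inj.1 h1).symm

/-! ### Null semigroups -/

theorem SGWord.eq_of_or_eq_mul (u : SGWord) :
    (∃ x, u = FreeSemigroup.of x) ∨ ∃ v w : SGWord, u = v * w := by
  induction u using FreeSemigroup.recOnMul with
  | ih1 x => exact Or.inl ⟨x, rfl⟩
  | ih2 x y _ _ => exact Or.inr ⟨_, y, rfl⟩

theorem mem_modelsOf_ZMvar {S : ComSG} :
    S ∈ modelsOf ZMvar.theory ↔ ∀ a b c d : S.carrier, a * b = c * d := by
  rw [ZMvar, mem_modelsOf_comVar]
  constructor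
  · intro h
    have h1 : ∀ a b c : S.carrier, a * b * c = a * b := by
      intro a b c
      simpa [ltr] using h (ltr 0 * ltr 1 * ltr 2, ltr 0 * ltr 1) (by simp [zeroId])
        fun n => if n = 0 then a else if n = 1 then b else c
    intro a b c d
    rw [← h1 a b (c * d), mul_comm, h1 c d]
  · rintro h i (rfl | rfl | rfl) f
    · exact h _ _ _ _
    · exact h _ _ _ _
    · exact h _ _ _ _

theorem isNilVariety_ZMvar : IsNilVariety ZMvar := by
  intro S hS
  rw [mem_modelsOf_ZMvar] at hS
  obtain ⟨s⟩ := S.instNonempty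
  exact ⟨s * s, fun a => ⟨hS _ _ _ _, hS _ _ _ _⟩, fun a => ⟨2, by simp, hS _ _ _ _⟩⟩

/-- The two-element null semigroup. -/
def nullSG : ComSG where
  carrier := Bool
  str := { mul := fun _ _ => false, mul_assoc := fun _ _ _ => rfl, mul_comm := fun _ _ => rfl }

theorem ZMvar_ne_bot : ZMvar ≠ ⊥ := by
  intro h
  have hle : ZMvar ≤ Tvar := h ▸ bot_le
  have hmem : nullSG ∈ modelsOf ZMvar.theory := mem_modelsOf_ZMvar.2 fun _ _ _ _ => rfl
  have hsat := mem_modelsOf_comVar.1 (ComVariety.modelsOf_theory_mono hle hmem)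
    (ltr 0, ltr 1) rfl fun n => (n == 0 : Bool)
  exact Bool.noConfusion (hsat : true = false)

theorem isRegularVariety_of_letter_eq {V : ComVariety} {x : ℕ} {v : SGWord}
    (h : (FreeSemigroup.of x, v) ∈ V.theory ∨ (v, FreeSemigroup.of x) ∈ V.theory)
    (hv : v ≠ FreeSemigroup.of x) : IsRegularVariety V := by
  have key : ∀ S ∈ modelsOf V.theory, ∀ f : ℕ → S.carrier, f x = FreeSemigroup.lift f v := by
    intro S hS f
    rcases h with h | h
    · simpa using hS _ h f
    · simpa using (hS _ h f).symm
  rcases v.eq_of_or_eq_mul with ⟨y, rfl⟩ | ⟨p, q, rfl⟩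
  · have hyx : y ≠ x := fun h => hv (by rw [h])
    refine ⟨1, le_rfl, fun S hS s => ?_⟩
    have := key S hS fun n => if n = x then s * s else s
    simp only [if_true, FreeSemigroup.lift_of, if_neg hyx] at this
    rw [pow_succ, pow_one, ← WithOne.coe_mul, this]
  · have h1 := p.card_letters_pos
    have h2 := q.card_letters_pos
    refine ⟨Multiset.card (SGWord.letters p) + Multiset.card (SGWord.letters q) - 1, by omega,
      fun S hS s => ?_⟩
    have := congrArg (fun t : S.carrier => (t : WithOne S.carrier)) (key S hS fun _ => s)
    simp only [coe_lift_eq_prod, SGWord.letters_mul, Multiset.map_const', Multiset.prod_replicate,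
      Multiset.card_add] at this
    rw [Nat.sub_add_cancel (by omega), ← this]

theorem isRegularVariety_of_not_ZMvar_le {V : ComVariety} (h : ¬ ZMvar ≤ V) :
    IsRegularVariety V := by
  obtain ⟨⟨u, v⟩, hi, hni⟩ := Set.not_subset.1 h
  have huv : u ≠ v := by
    rintro rfl
    exact hni ((ComVariety.mem_theory_iff _ _).2 fun S _ f => rfl)
  rcases u.eq_of_or_eq_mul with ⟨x, rfl⟩ | ⟨p, q, rfl⟩
  · exact isRegularVariety_of_letter_eq (Or.inl hi) huv.symm
  rcases v.eq_of_or_eq_mul with ⟨x, rfl⟩ | ⟨p', q', rfl⟩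
  · exact isRegularVariety_of_letter_eq (Or.inr hi) huv
  refine absurd ((ComVariety.mem_theory_iff _ _).2 fun S hS f => ?_) hni
  simpa using mem_modelsOf_ZMvar.1 hS _ _ _ _

theorem IsNilVariety.ZMvar_le {V : ComVariety} (hV : IsNilVariety V) (hb : V ≠ ⊥) : ZMvar ≤ V :=
  by_contra fun h => hb (hV.eq_bot_of_isRegularVariety (isRegularVariety_of_not_ZMvar_le h))

/-! ### Semilattices -/

/-- The variety generated by the two-element semilattice. -/
def semilatticeVar : ComVariety := varGeneratedBy ⟨ZMod 2⟩

theorem mem_theory_semilatticeVar {i : SGId} :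
    i ∈ semilatticeVar.theory ↔
      ∀ x, x ∈ SGWord.letters i.1 ↔ x ∈ SGWord.letters i.2 := by
  have hsat : i ∈ semilatticeVar.theory ↔ SGSatisfies (ZMod 2) i := Iff.rfl
  have key : ∀ (f : ℕ → ZMod 2) (u : SGWord), ((SGWord.letters u).map f).prod = 0 ↔
      ∃ x ∈ SGWord.letters u, f x = 0 := by
    intro f u
    simp [Multiset.prod_eq_zero_iff]
  rw [hsat, sgSatisfies_iff_prod_monoid]
  constructor
  · intro h x
    have h1 := h fun y => if y = x then 0 else 1
    have h2 := key (fun y => if y = x then 0 else 1) i.1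
    rw [h1, key] at h2
    simpa using h2.symm
  · intro h f
    have h2 : ∀ a b : ZMod 2, (a = 0 ↔ b = 0) → a = b := by decide
    refine h2 _ _ ?_
    rw [key, key]
    simp only [h]

theorem semilatticeVar_ne_bot : semilatticeVar ≠ ⊥ := by
  intro h
  have h1 : (FreeSemigroup.of 0, FreeSemigroup.of 1) ∈ semilatticeVar.theory := by
    have h2 : semilatticeVar ≤ Tvar := h ▸ bot_le
    exact h2 (subset_theoryOfClass_modelsOf _ rfl)
  simpa [SGWord.letters_of] using mem_theory_semilatticeVar.1 h1 0

theorem mul_pow_eq_of_mul_eq {M : Type*} [Monoid M] {a b : M} (h : a * b = a) (k : ℕ) :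
    a * b ^ k = a := by
  induction k with
  | zero => simp
  | succ k ih => rw [pow_succ', ← mul_assoc, h, ih]

theorem exists_pow_eq_pow_of_not_semilatticeVar_le {V : ComVariety} (h : ¬ semilatticeVar ≤ V) :
    ∃ m, 1 ≤ m ∧ ∀ S ∈ modelsOf V.theory, ∀ s t : S.carrier,
      (s : WithOne S.carrier) ^ m = (t : WithOne S.carrier) ^ m := by
  obtain ⟨i, hi, hni⟩ := Set.not_subset.1 h
  rw [mem_theory_semilatticeVar] at hni
  obtain ⟨x, u, v, hxu, hxv, H⟩ : ∃ (x : ℕ) (u v : SGWord), x ∈ SGWord.letters u ∧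
      x ∉ SGWord.letters v ∧ ∀ S ∈ modelsOf V.theory, SGSatisfies S.carrier (u, v) := by
    push Not at hni
    obtain ⟨x, ⟨h1, h2⟩ | ⟨h1, h2⟩⟩ := hni
    · exact ⟨x, i.1, i.2, h1, h2, fun S hS => hS i hi⟩
    · exact ⟨x, i.2, i.1, h2, h1, fun S hS f => (hS i hi f).symm⟩
  set c := (SGWord.letters u).count x with hc
  set l := Multiset.card (SGWord.letters v) with hl
  set k := Multiset.card (SGWord.letters u) - c
  have hc0 : 0 < c := Multiset.count_pos.2 hxu
  have hl0 : 0 < l := v.card_letters_pos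
  refine ⟨l * c, Nat.mul_pos hl0 hc0, fun S hS => ?_⟩
  have h1 : ∀ s t : S.carrier, (t : WithOne S.carrier) ^ c * (s : WithOne S.carrier) ^ k =
      (s : WithOne S.carrier) ^ l := by
    intro s t
    have := (sgSatisfies_iff_prod (u, v)).1 (H S hS) fun y => if y = x then t else s
    simp only [apply_ite (fun a : S.carrier => (a : WithOne S.carrier)),
      Multiset.prod_map_ite_eq, Multiset.count_eq_zero_of_notMem hxv] at this
    simpa using this
  have h2 : ∀ s t : S.carrier, (s : WithOne S.carrier) ^ l * (t : WithOne S.carrier) ^ c =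
      (s : WithOne S.carrier) ^ l := by
    intro s t
    have h3 := h1 s (t * t)
    rw [WithOne.coe_mul, mul_pow, mul_assoc, h1] at h3
    rw [mul_comm, h3]
  have h4 : ∀ s t : S.carrier, (s : WithOne S.carrier) ^ (l * c) *
      (t : WithOne S.carrier) ^ (l * c) = (s : WithOne S.carrier) ^ (l * c) := by
    intro s t
    have h5 := mul_pow_eq_of_mul_eq (h2 s t) l
    rw [← pow_mul, mul_comm c l] at h5
    obtain ⟨c', hc'⟩ : ∃ c', c = c' + 1 := ⟨c - 1, by omega⟩
    have h6 : (s : WithOne S.carrier) ^ (l * c) = s ^ (l * c') * s ^ l := by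
      rw [hc', mul_add, pow_add, mul_one]
    rw [h6, mul_assoc, h5]
  intro s t
  rw [← h4 s t, mul_comm, h4 t s]

theorem le_semilatticeVar_of_sq_eq {V : ComVariety}
    (h : ∀ S ∈ modelsOf V.theory, ∀ s : S.carrier, (s : WithOne S.carrier) ^ 2 = s) :
    V ≤ semilatticeVar := by
  intro i hi
  rw [mem_theory_semilatticeVar] at hi
  refine (V.mem_theory_iff i).2 fun S hS => (sgSatisfies_iff_prod i).2 fun f => ?_
  rw [Finset.prod_multiset_map_count, Finset.prod_multiset_map_count]
  have key : ∀ u : SGWord, ∏ x ∈ (SGWord.letters u).toFinset,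
      (f x : WithOne S.carrier) ^ (SGWord.letters u).count x =
      ∏ x ∈ (SGWord.letters u).toFinset, (f x : WithOne S.carrier) := by
    intro u
    refine Finset.prod_congr rfl fun x hx => ?_
    have h1 : 0 < (SGWord.letters u).count x := Multiset.count_pos.2 (Multiset.mem_toFinset.1 hx)
    obtain ⟨c, hc⟩ : ∃ c, (SGWord.letters u).count x = 1 * c + 1 :=
      ⟨(SGWord.letters u).count x - 1, by omega⟩
    rw [hc]
    exact pow_mul_add_one_of_pow_succ_eq (h S hS (f x)) c
  rw [key, key]
  congr 1
  ext x
  simpa using hi x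

theorem sq_eq_of_le_semilatticeVar {V : ComVariety} (h : V ≤ semilatticeVar) :
    ∀ S ∈ modelsOf V.theory, ∀ s : S.carrier, (s : WithOne S.carrier) ^ 2 = s := by
  intro S hS s
  have h1 : (letterPow 0 1, letterPow 0 0) ∈ semilatticeVar.theory :=
    mem_theory_semilatticeVar.2 fun x => by simp [letters_letterPow]
  have := (sgSatisfies_iff_prod _).1 (hS _ (h h1)) fun _ => s
  simpa only [letters_letterPow, Multiset.map_replicate, Multiset.prod_replicate, zero_add,
    pow_one] using this

theorem isRegularVariety_semilatticeVar : IsRegularVariety semilatticeVar :=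
  ⟨1, le_rfl, sq_eq_of_le_semilatticeVar le_rfl⟩

theorem eq_bot_or_eq_semilatticeVar {V : ComVariety} (h : V ≤ semilatticeVar) :
    V = ⊥ ∨ V = semilatticeVar := by
  by_cases h1 : semilatticeVar ≤ V
  · exact Or.inr (le_antisymm h h1)
  left
  obtain ⟨m, hm, H⟩ := exists_pow_eq_pow_of_not_semilatticeVar_le h1
  refine ComVariety.eq_bot_of_subsingleton fun S hS s t => ?_
  obtain ⟨m, rfl⟩ : ∃ k, m = 1 * k + 1 := ⟨m - 1, by omega⟩
  have h2 := H S hS s t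
  rw [pow_mul_add_one_of_pow_succ_eq (sq_eq_of_le_semilatticeVar h S hS s),
    pow_mul_add_one_of_pow_succ_eq (sq_eq_of_le_semilatticeVar h S hS t)] at h2
  exact WithOne.coe_inj.1 h2

theorem isAtom_semilatticeVar : IsAtom semilatticeVar :=
  ⟨semilatticeVar_ne_bot, fun _ h => (eq_bot_or_eq_semilatticeVar h.le).resolve_right h.ne⟩

/-! ### Varieties of Abelian groups -/

/-- The variety generated by the cyclic group of order `m`. -/
def cyclicVar (m : ℕ) : ComVariety := varGeneratedBy ⟨Multiplicative (ZMod m)⟩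

theorem mem_theory_cyclicVar {m : ℕ} {i : SGId} :
    i ∈ (cyclicVar m).theory ↔
      ∀ x, (SGWord.letters i.1).count x ≡ (SGWord.letters i.2).count x [MOD m] := by
  have hsat : i ∈ (cyclicVar m).theory ↔ SGSatisfies (Multiplicative (ZMod m)) i := Iff.rfl
  rw [hsat, sgSatisfies_iff_prod_monoid]
  constructor
  · intro h x
    have h1 := h fun y => if y = x then Multiplicative.ofAdd 1 else 1
    rw [Multiset.prod_map_ite_eq, Multiset.prod_map_ite_eq, one_pow, one_pow, mul_one, mul_one,
      ← ofAdd_nsmul, ← ofAdd_nsmul] at h1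
    have h2 := Multiplicative.ofAdd.injective h1
    rw [nsmul_one, nsmul_one] at h2
    exact (ZMod.natCast_eq_natCast_iff _ _ _).1 h2
  · intro h f
    rw [Multiset.prod_map_eq_prod_of_subset f Finset.subset_union_left,
      Multiset.prod_map_eq_prod_of_subset f Finset.subset_union_right]
    refine Finset.prod_congr rfl fun x _ => ?_
    have h2 := (ZMod.natCast_eq_natCast_iff _ _ _).2 (h x)
    apply Multiplicative.toAdd.injective
    rw [toAdd_pow, toAdd_pow, nsmul_eq_mul, nsmul_eq_mul, h2]

theorem letterPow_mem_theory_cyclicVar (m : ℕ) :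
    (letterPow 0 m, letterPow 0 0) ∈ (cyclicVar m).theory :=
  mem_theory_cyclicVar.2 fun x => by
    rw [letters_letterPow, letters_letterPow, Multiset.count_replicate, Multiset.count_replicate]
    split_ifs
    · simp [Nat.ModEq]
    · rfl

theorem cyclicVar_le_iff {k m : ℕ} : cyclicVar k ≤ cyclicVar m ↔ k ∣ m := by
  constructor
  · intro h
    have h2 := mem_theory_cyclicVar.1 (h (letterPow_mem_theory_cyclicVar m)) 0
    simp only [letters_letterPow, Multiset.count_replicate_self, zero_add] at h2
    exact (Nat.modEq_zero_iff_dvd).1 (Nat.ModEq.add_right_cancel' 1 (by simpa using h2))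
  · exact fun h i hi => mem_theory_cyclicVar.2 fun x => (mem_theory_cyclicVar.1 hi x).of_dvd h

theorem cyclicVar_one : cyclicVar 1 = ⊥ :=
  le_bot_iff.1 fun _ _ => mem_theory_cyclicVar.2 fun _ => Nat.modEq_one

theorem cyclicVar_ne_bot {m : ℕ} (hm : m ≠ 1) : cyclicVar m ≠ ⊥ := fun h =>
  hm (Nat.dvd_one.1 (cyclicVar_le_iff.1 (h ▸ bot_le)))

theorem isRegularVariety_cyclicVar {m : ℕ} (hm : 1 ≤ m) : IsRegularVariety (cyclicVar m) := by
  refine ⟨m, hm, fun S hS s => ?_⟩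
  have := (sgSatisfies_iff_prod _).1 (hS _ (letterPow_mem_theory_cyclicVar m)) fun _ => s
  simpa only [letters_letterPow, Multiset.map_replicate, Multiset.prod_replicate, zero_add,
    pow_one] using this

theorem not_semilatticeVar_le_cyclicVar {m : ℕ} (hm : 1 ≤ m) : ¬ semilatticeVar ≤ cyclicVar m := by
  intro h
  obtain ⟨m, rfl⟩ := Nat.exists_eq_add_of_le' hm
  have h1 : (letterPow 0 m * FreeSemigroup.of 1, FreeSemigroup.of 1) ∈
      (cyclicVar (m + 1)).theory :=
    mem_theory_cyclicVar.2 fun x => by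
      rw [SGWord.letters_mul, letters_letterPow, Multiset.count_add, Multiset.count_replicate]
      split_ifs
      · simp [Nat.ModEq]
      · simp [Nat.ModEq]
  simpa [SGWord.letters_mul, SGWord.letters_of, letters_letterPow] using
    mem_theory_semilatticeVar.1 (h h1) 0

/-! ### Periods -/

/-- `p` is a period of `V` if `V` satisfies `x ^ (N + p) = x ^ N` for some `N`. -/
def IsPeriodOf (V : ComVariety) (p : ℕ) : Prop :=
  ∃ N, ∀ S ∈ modelsOf V.theory, ∀ s : S.carrier,
    (s : WithOne S.carrier) ^ (N + p) = (s : WithOne S.carrier) ^ N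

theorem pow_add_mul_of_pow_add_eq {M : Type*} [Monoid M] {a : M} {N p : ℕ}
    (h : a ^ (N + p) = a ^ N) (r k : ℕ) : a ^ (N + r + p * k) = a ^ (N + r) := by
  induction k with
  | zero => simp
  | succ k ih =>
    rw [show N + r + p * (k + 1) = (N + p) + (r + p * k) by ring, pow_add, h, ← pow_add,
      ← add_assoc, ih]

theorem IsPeriodOf.exists_minimal {V : ComVariety} {p : ℕ} (hp : 1 ≤ p) (h : IsPeriodOf V p) :
    ∃ d, 1 ≤ d ∧ IsPeriodOf V d ∧ ∀ q, IsPeriodOf V q → d ∣ q := by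
  classical
  have hex : ∃ d, 1 ≤ d ∧ IsPeriodOf V d := ⟨p, hp, h⟩
  obtain ⟨hd, hV⟩ := Nat.find_spec hex
  refine ⟨Nat.find hex, hd, hV, fun q hq => ?_⟩
  set d := Nat.find hex
  have hr : IsPeriodOf V (q % d) := by
    obtain ⟨N, hN⟩ := hV
    obtain ⟨K, hK⟩ := hq
    refine ⟨N + K, fun S hS s => ?_⟩
    rw [← pow_add_mul_of_pow_add_eq (hN S hS s) K 0,
      show N + K + q % d = N + (K + q % d) by ring,
      ← pow_add_mul_of_pow_add_eq (hN S hS s) (K + q % d) (q / d),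
      show N + (K + q % d) + d * (q / d) = N + (K + (q % d + d * (q / d))) by ring,
      Nat.mod_add_div, pow_add _ N, hK S hS s, ← pow_add]
    simp
  by_contra hnd
  exact Nat.find_min hex (Nat.mod_lt q hd)
    ⟨Nat.one_le_iff_ne_zero.2 fun h0 => hnd (Nat.dvd_of_mod_eq_zero h0), hr⟩

theorem isPeriodOf_sub {V : ComVariety} {N a b : ℕ} (hab : a ≤ b)
    (h : ∀ S ∈ modelsOf V.theory, ∀ s : S.carrier,
      (s : WithOne S.carrier) ^ (N + a) = (s : WithOne S.carrier) ^ (N + b)) :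
    IsPeriodOf V (b - a) :=
  ⟨N + a, fun S hS s => by rw [h S hS s]; congr 1; omega⟩

theorem cyclicVar_le_of_minimal_period {V : ComVariety} {d : ℕ} (hd : 1 ≤ d)
    (hV : IsPeriodOf V d) (hmin : ∀ q, IsPeriodOf V q → d ∣ q) : cyclicVar d ≤ V := by
  intro i hi
  refine mem_theory_cyclicVar.2 fun x => ?_
  obtain ⟨N, hN⟩ := hV
  have key : ∀ S ∈ modelsOf V.theory, ∀ s : S.carrier,
      (s : WithOne S.carrier) ^ (N + (SGWord.letters i.1).count x) =
        (s : WithOne S.carrier) ^ (N + (SGWord.letters i.2).count x) := by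
    intro S hS s
    obtain ⟨t, ht⟩ := WithOne.exists_coe_eq_pow s hd
    have h1 := (sgSatisfies_iff_prod i).1 (hS i hi) fun y => if y = x then s else t
    simp only [apply_ite (fun a : S.carrier => (a : WithOne S.carrier)),
      Multiset.prod_map_ite_eq, ht] at h1
    have h2 := congrArg (fun a => (s : WithOne S.carrier) ^ N * a) h1
    simp only [← pow_mul, ← pow_add, ← add_assoc] at h2
    rwa [pow_add_mul_of_pow_add_eq (hN S hS s), pow_add_mul_of_pow_add_eq (hN S hS s)] at h2
  rcases le_total ((SGWord.letters i.1).count x) ((SGWord.letters i.2).count x) with h | h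
  · exact (Nat.modEq_iff_dvd' h).2 (hmin _ (isPeriodOf_sub h key))
  · exact ((Nat.modEq_iff_dvd' h).2
      (hmin _ (isPeriodOf_sub h fun S hS s => (key S hS s).symm))).symm

theorem IsRegularVariety.isPeriodOf {V : ComVariety} (h : IsRegularVariety V) :
    ∃ p, 1 ≤ p ∧ IsPeriodOf V p := by
  obtain ⟨n, hn, H⟩ := h
  exact ⟨n, hn, 1, fun S hS s => by rw [add_comm, H S hS s, pow_one]⟩

theorem IsRegularVariety.pow_succ_eq_of_isPeriodOf {V : ComVariety} (h : IsRegularVariety V)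
    {d : ℕ} (hd : IsPeriodOf V d) :
    ∀ S ∈ modelsOf V.theory, ∀ s : S.carrier, (s : WithOne S.carrier) ^ (d + 1) = s := by
  obtain ⟨n, hn, H⟩ := h
  obtain ⟨N, hN⟩ := hd
  intro S hS s
  have h1 := pow_mul_add_one_of_pow_succ_eq (H S hS s) N
  obtain ⟨n, rfl⟩ := Nat.exists_eq_add_of_le' hn
  have h2 := congrArg (fun a => a * (s : WithOne S.carrier) ^ (n * N + 1)) (hN S hS s)
  simp only [← pow_add] at h2
  rw [show N + (n * N + 1) = (n + 1) * N + 1 by ring, h1,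
    show N + d + (n * N + 1) = d + ((n + 1) * N + 1) by ring, pow_add, h1, ← pow_succ] at h2
  exact h2

theorem mul_prod_pow_eq_of_modEq {M : Type*} [CommMonoid M] {d : ℕ} {e : M} {f : ℕ → M}
    (hf : ∀ x, e * f x ^ d = e) {a b : ℕ → ℕ} (hab : ∀ x, a x ≡ b x [MOD d]) (F : Finset ℕ) :
    e * ∏ x ∈ F, f x ^ a x = e * ∏ x ∈ F, f x ^ b x := by
  have hmod : ∀ x k, e * f x ^ k = e * f x ^ (k % d) := by
    intro x k
    conv_lhs => rw [← Nat.div_add_mod k d, pow_add, pow_mul, ← mul_assoc,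
      mul_pow_eq_of_mul_eq (hf x)]
  induction F using Finset.induction_on with
  | empty => simp
  | insert x F hx ih =>
    rw [Finset.prod_insert hx, Finset.prod_insert hx, mul_left_comm, ih, mul_left_comm,
      ← mul_assoc, hmod, hab x, ← hmod, mul_assoc]

theorem exists_eq_cyclicVar {V : ComVariety} (hr : IsRegularVariety V)
    (hs : ¬ semilatticeVar ≤ V) : ∃ m, 1 ≤ m ∧ V = cyclicVar m := by
  obtain ⟨p, hp, hpV⟩ := hr.isPeriodOf
  obtain ⟨d, hd, hdV, hmin⟩ := hpV.exists_minimal hp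
  refine ⟨d, hd, le_antisymm ?_ (cyclicVar_le_of_minimal_period hd hdV hmin)⟩
  intro i hi
  rw [mem_theory_cyclicVar] at hi
  obtain ⟨m, hm, hpow⟩ := exists_pow_eq_pow_of_not_semilatticeVar_le hs
  have hreg := hr.pow_succ_eq_of_isPeriodOf hdV
  refine (V.mem_theory_iff i).2 fun S hS => (sgSatisfies_iff_prod i).2 fun f => ?_
  have hidem : ∀ s : S.carrier, ∀ k, 1 ≤ k →
      ((s : WithOne S.carrier) ^ d) ^ k = (s : WithOne S.carrier) ^ d := by
    intro s k hk
    have h1 : (s : WithOne S.carrier) ^ d * (s : WithOne S.carrier) ^ d = s ^ d := by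
      obtain ⟨d', rfl⟩ := Nat.exists_eq_add_of_le' hd
      conv_lhs => rw [← pow_add, show d' + 1 + (d' + 1) = d' + (d' + 1 + 1) by ring, pow_add,
        hreg S hS s, ← pow_succ]
    obtain ⟨k, rfl⟩ := Nat.exists_eq_add_of_le' hk
    rw [pow_succ', mul_pow_eq_of_mul_eq h1]
  have hone : ∀ s t : S.carrier, (s : WithOne S.carrier) ^ d = (t : WithOne S.carrier) ^ d := by
    intro s t
    rw [← hidem s m hm, ← hidem t m hm, ← pow_mul, ← pow_mul, mul_comm, pow_mul, pow_mul,
      hpow S hS s t]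
  have hunit : ∀ s t : S.carrier, (s : WithOne S.carrier) ^ d * t = t := by
    intro s t
    rw [hone s t, ← pow_succ, hreg S hS t]
  have hword : ∀ u : SGWord, (f 0 : WithOne S.carrier) ^ d *
      ((SGWord.letters u).map fun x => (f x : WithOne S.carrier)).prod =
      ((SGWord.letters u).map fun x => (f x : WithOne S.carrier)).prod := by
    intro u
    rw [← coe_lift_eq_prod, hunit]
  rw [← hword i.1, ← hword i.2,
    Multiset.prod_map_eq_prod_of_subset _ Finset.subset_union_left,
    Multiset.prod_map_eq_prod_of_subset _ Finset.subset_union_right]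
  refine mul_prod_pow_eq_of_modEq (fun x => ?_) hi _
  rw [hone (f x) (f 0), ← pow_two, hidem _ 2 (by simp)]

theorem isAtom_cyclicVar {p : ℕ} (hp : p.Prime) : IsAtom (cyclicVar p) := by
  refine ⟨cyclicVar_ne_bot hp.one_lt.ne', fun W hW => ?_⟩
  obtain ⟨m, hm, rfl⟩ := exists_eq_cyclicVar
    ((isRegularVariety_cyclicVar hp.one_lt.le).mono hW.le)
    fun h => not_semilatticeVar_le_cyclicVar hp.one_lt.le (h.trans hW.le)
  rcases (Nat.dvd_prime hp).1 (cyclicVar_le_iff.1 hW.le) with rfl | rfl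
  · exact cyclicVar_one
  · exact absurd rfl hW.ne

/-! ### Nil-varieties and atoms -/

theorem isNilVariety_of_forall_isAtom {V : ComVariety}
    (h : ∀ A : ComVariety, IsAtom A → A ≤ V → A = ZMvar) : IsNilVariety V := by
  have hreg : ∀ A : ComVariety, IsAtom A → IsRegularVariety A → ¬ A ≤ V := by
    intro A hA hr hle
    rw [h A hA hle] at hr
    exact ZMvar_ne_bot (isNilVariety_ZMvar.eq_bot_of_isRegularVariety hr)
  obtain ⟨m, hm, hpow⟩ := exists_pow_eq_pow_of_not_semilatticeVar_le
    (hreg _ isAtom_semilatticeVar isRegularVariety_semilatticeVar)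
  have hper : IsPeriodOf V m := by
    refine ⟨m, fun S hS s => ?_⟩
    rw [← two_mul, mul_comm, pow_mul', pow_two, ← WithOne.coe_mul]
    exact hpow S hS _ _
  obtain ⟨d, hd, hdV, hmin⟩ := hper.exists_minimal hm
  have hle := cyclicVar_le_of_minimal_period hd hdV hmin
  obtain rfl : d = 1 := by
    by_contra hd1
    obtain ⟨p, hp, hpd⟩ := Nat.exists_prime_and_dvd hd1
    exact hreg _ (isAtom_cyclicVar hp) (isRegularVariety_cyclicVar hp.one_lt.le)
      ((cyclicVar_le_iff.2 hpd).trans hle)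
  obtain ⟨N, hN⟩ := hdV
  intro S hS
  obtain ⟨s₀⟩ := S.instNonempty
  obtain ⟨z, hz⟩ := WithOne.exists_coe_eq_pow s₀ hm
  have hmul : ∀ a : S.carrier, z * a = z := by
    intro a
    obtain ⟨b, hb⟩ := WithOne.exists_coe_eq_pow a (Nat.succ_pos N)
    have hza : (z : WithOne S.carrier) = (b : WithOne S.carrier) ^ m := by rw [hz, hpow S hS s₀ b]
    have hba : (b : WithOne S.carrier) * a = b := by
      rw [hb, Nat.succ_eq_add_one, hN S hS a, ← pow_succ, hN S hS a]
    refine WithOne.coe_inj.1 ?_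
    obtain ⟨m, rfl⟩ := Nat.exists_eq_add_of_le' hm
    rw [WithOne.coe_mul, hza, pow_succ, mul_assoc, hba]
  refine ⟨z, fun a => ⟨hmul a, by rw [mul_comm, hmul]⟩, fun a => ⟨m, hm, ?_⟩⟩
  obtain ⟨m, rfl⟩ := Nat.exists_eq_add_of_le' hm
  exact WithOne.coe_inj.1 (by rw [coe_spow, hz, hpow S hS a s₀])

theorem isNilVariety_iff_forall_isAtom {V : ComVariety} :
    IsNilVariety V ↔ ∀ A : ComVariety, IsAtom A → A ≤ V → A = ZMvar := by
  refine ⟨fun hV A hA hle => ?_, isNilVariety_of_forall_isAtom⟩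
  exact ((hA.le_iff_eq ZMvar_ne_bot).1 ((hV.mono hle).ZMvar_le hA.1)).symm

/-! ### A lattice-theoretic characterization of `ZM` among the atoms -/

/-- `a` lies below every nonzero element of some principal ideal that is not a chain. -/
def IsMonolithOfNonchain {L : Type*} [Lattice L] (a : L) : Prop :=
  ∃ v w₁ w₂ : L, w₁ ≤ v ∧ w₂ ≤ v ∧ ¬ w₁ ≤ w₂ ∧ ¬ w₂ ≤ w₁ ∧
    ∀ b, b ≤ v → (∀ c, b ≤ c) ∨ a ≤ b

/-- Nonzero words in three commuting square-zero letters, coded by bit masks. -/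
def squareZeroSG : ComSG where
  carrier := Fin 8
  str :=
    { mul := fun a b => if a = 0 ∨ b = 0 ∨ a &&& b ≠ 0 then 0 else a ||| b
      mul_assoc := by decide +kernel
      mul_comm := by decide +kernel }
  instNonempty := ⟨(0 : Fin 8)⟩

/-- The semigroup `{x, x², 0}` with `x³ = 0`. -/
def cubeZeroSG : ComSG where
  carrier := Fin 3
  str :=
    { mul := fun a b => if a = 0 ∧ b = 0 then 1 else 2
      mul_assoc := by decide
      mul_comm := by decide }
  instNonempty := ⟨(0 : Fin 3)⟩

instance : Fintype squareZeroSG.carrier := inferInstanceAs (Fintype (Fin 8))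

instance : DecidableEq squareZeroSG.carrier := inferInstanceAs (DecidableEq (Fin 8))

instance : Fintype cubeZeroSG.carrier := inferInstanceAs (Fintype (Fin 3))

instance : DecidableEq cubeZeroSG.carrier := inferInstanceAs (DecidableEq (Fin 3))

/-- The identity `x³y = x³`. -/
def cubeId : SGId := (ltr 0 * ltr 0 * ltr 0 * ltr 1, ltr 0 * ltr 0 * ltr 0)

theorem sgSatisfies_cubeId_iff {S : Type} [Semigroup S] :
    SGSatisfies S cubeId ↔ ∀ a b : S, a * a * a * b = a * a * a := by
  constructor
  · intro h a b
    simpa [cubeId, ltr] using h fun n => if n = 0 then a else b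
  · intro h f
    simpa [cubeId, ltr] using h (f 0) (f 1)

theorem isNilVariety_comVar_cubeId : IsNilVariety (comVar {cubeId}) := by
  intro S hS
  have h := sgSatisfies_cubeId_iff.1 (mem_modelsOf_comVar.1 hS cubeId rfl)
  obtain ⟨s⟩ := S.instNonempty
  refine ⟨s * s * s, fun a => ⟨h s a, by rw [mul_comm, h s a]⟩, fun a => ⟨3, by simp, ?_⟩⟩
  change a * a * a = s * s * s
  rw [← h a (s * s * s), mul_comm, h]

theorem isMonolithOfNonchain_ZMvar : IsMonolithOfNonchain ZMvar := by
  refine ⟨comVar {cubeId}, varGeneratedBy squareZeroSG, varGeneratedBy cubeZeroSG,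
    varGeneratedBy_le_comVar ?_, varGeneratedBy_le_comVar ?_, ?_, ?_, fun b hb => ?_⟩
  · rintro i rfl
    refine sgSatisfies_cubeId_iff.2 ?_
    decide +kernel
  · rintro i rfl
    refine sgSatisfies_cubeId_iff.2 ?_
    decide +kernel
  · intro h
    have h1 : (ltr 0 * ltr 1 * ltr 2 * ltr 3, ltr 0 * ltr 1 * ltr 2) ∈
        (varGeneratedBy cubeZeroSG).theory := by
      intro f
      have key : ∀ a b c d : cubeZeroSG.carrier, a * b * c * d = a * b * c := by decide +kernel
      exact key (f 0) (f 1) (f 2) (f 3)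
    have key : ¬ ∀ a b c d : squareZeroSG.carrier, a * b * c * d = a * b * c := by decide +kernel
    exact key fun a b c d =>
      h h1 fun n => if n = 0 then a else if n = 1 then b else if n = 2 then c else d
  · intro h
    have h1 : (ltr 0 * ltr 0 * ltr 1, ltr 0 * ltr 0) ∈ (varGeneratedBy squareZeroSG).theory := by
      intro f
      have key : ∀ a b : squareZeroSG.carrier, a * a * b = a * a := by decide +kernel
      exact key (f 0) (f 1)
    have key : ¬ ∀ a b : cubeZeroSG.carrier, a * a * b = a * a := by decide +kernel
    exact key fun a b => h h1 fun n => if n = 0 then a else b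
  · rcases eq_or_ne b ⊥ with rfl | hb0
    · exact Or.inl fun c => bot_le
    · exact Or.inr ((isNilVariety_comVar_cubeId.mono hb).ZMvar_le hb0)

theorem IsAtom.isMonolithOfNonchain_iff {A : ComVariety} (hA : IsAtom A) :
    IsMonolithOfNonchain A ↔ A = ZMvar := by
  refine ⟨?_, fun h => h ▸ isMonolithOfNonchain_ZMvar⟩
  rintro ⟨V, W₁, W₂, h₁, h₂, h₁₂, h₂₁, hmono⟩
  replace hmono : ∀ B ≤ V, B ≠ ⊥ → A ≤ B := fun B hB hB0 =>
    (hmono B hB).resolve_left fun h => hB0 (le_bot_iff.1 (h ⊥))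
  by_contra hAZ
  have hreg : IsRegularVariety V := isRegularVariety_of_not_ZMvar_le fun hle => by
    have hAle := hmono _ hle ZMvar_ne_bot
    exact hAZ (le_antisymm hAle ((isNilVariety_ZMvar.mono hAle).ZMvar_le hA.1))
  by_cases hs : semilatticeVar ≤ V
  · obtain ⟨p, hp, hpV⟩ := hreg.isPeriodOf
    obtain ⟨d, hd, hdV, hmin⟩ := hpV.exists_minimal hp
    rcases eq_or_ne d 1 with rfl | hd1
    · have hle := le_semilatticeVar_of_sq_eq (hreg.pow_succ_eq_of_isPeriodOf hdV)
      rcases eq_bot_or_eq_semilatticeVar (h₁.trans hle) with rfl | rfl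
      · exact h₁₂ bot_le
      · exact h₂₁ (h₂.trans hle)
    · have hle := hmono _ (cyclicVar_le_of_minimal_period hd hdV hmin) (cyclicVar_ne_bot hd1)
      have hAs := (eq_bot_or_eq_semilatticeVar
        (hmono _ hs semilatticeVar_ne_bot)).resolve_left hA.1
      exact not_semilatticeVar_le_cyclicVar hd (hAs ▸ hle)
  · have hcyc : ∀ W ≤ V, ∃ m, 1 ≤ m ∧ W = cyclicVar m := fun W hW =>
      exists_eq_cyclicVar (hreg.mono hW) fun h => hs (h.trans hW)
    obtain ⟨m, hm, rfl⟩ := hcyc W₁ h₁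
    obtain ⟨n, hn, rfl⟩ := hcyc W₂ h₂
    rw [cyclicVar_le_iff] at h₁₂ h₂₁
    have hAV : A ≤ V := (hmono _ h₁ fun h => h₁₂ (cyclicVar_le_iff.1 (h ▸ bot_le))).trans h₁
    obtain ⟨k, hk, rfl⟩ := hcyc A hAV
    have hg : 0 < m.gcd n := Nat.gcd_pos_of_pos_left _ hm
    have key : ∀ q r : ℕ, q ∣ r → cyclicVar r ≤ V → q ≠ 1 → k ∣ q := fun q r hqr hr hq =>
      cyclicVar_le_iff.1 (hmono _ ((cyclicVar_le_iff.2 hqr).trans hr) (cyclicVar_ne_bot hq))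
    have hkm := key (m / m.gcd n) m (Nat.div_dvd_of_dvd (Nat.gcd_dvd_left m n)) h₁
      fun h => h₁₂ <| by
      have := Nat.eq_of_dvd_of_div_eq_one (Nat.gcd_dvd_left m n) h
      exact this ▸ Nat.gcd_dvd_right m n
    have hkn := key (n / m.gcd n) n (Nat.div_dvd_of_dvd (Nat.gcd_dvd_right m n)) h₂
      fun h => h₂₁ <| by
      have := Nat.eq_of_dvd_of_div_eq_one (Nat.gcd_dvd_right m n) h
      exact this ▸ Nat.gcd_dvd_left m n
    have hk1 : k = 1 := Nat.eq_one_of_dvd_coprimes (Nat.coprime_div_gcd_div_gcd hg) hkm hkn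
    exact hA.1 (hk1 ▸ cyclicVar_one)

/-! ### The defining formula -/

section Formulas

open FirstOrder.Language

/-- The function symbol for the meet. -/
def meetSymbol : latticeLang.Functions 2 := false

/-- The formula `t ∧ s = t`, expressing `t ≤ s`. -/
def leFormula {α : Type} {n : ℕ} (t s : latticeLang.Term (α ⊕ Fin n)) :
    latticeLang.BoundedFormula α n :=
  (Functions.apply₂ meetSymbol t s).bdEqual t

theorem realize_leFormula {L : Type*} [Lattice L] {α : Type} {n : ℕ}
    (t s : latticeLang.Term (α ⊕ Fin n)) (v : α → L) (xs : Fin n → L) :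
    (leFormula t s).Realize v xs ↔
      t.realize (Sum.elim v xs) ≤ s.realize (Sum.elim v xs) := by
  rw [leFormula, BoundedFormula.realize_bdEqual, Term.realize_functions_apply₂, ← inf_eq_left]
  rfl

/-- The bound variable `i` in a context of `n` bound variables. -/
def bvar {n : ℕ} (i : Fin n) : latticeLang.Term (Fin 1 ⊕ Fin n) := Term.var (Sum.inr i)

/-- The formula stating that the bound variable `i` is the least element. -/
def botFormula {n : ℕ} (i : Fin n) : latticeLang.BoundedFormula (Fin 1) n :=
  (leFormula (bvar i.castSucc) (bvar (Fin.last n))).all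

theorem realize_botFormula {L : Type*} [Lattice L] {n : ℕ} (i : Fin n) (v : Fin 1 → L)
    (xs : Fin n → L) : (botFormula i).Realize v xs ↔ ∀ c, xs i ≤ c := by
  simp [botFormula, realize_leFormula, bvar]

/-- The formula stating that the bound variable `0` is an atom. -/
def atomFormula : latticeLang.BoundedFormula (Fin 1) 1 :=
  (botFormula 0).not ⊓
    ((leFormula (bvar 1) (bvar 0)).imp (botFormula 1 ⊔ leFormula (n := 2) (bvar 0) (bvar 1))).all

theorem realize_atomFormula {L : Type*} [Lattice L] [OrderBot L] (v : Fin 1 → L)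
    (xs : Fin 1 → L) : atomFormula.Realize v xs ↔ IsAtom (xs 0) := by
  have h0 : ∀ b : L, (Fin.snoc xs b : Fin 2 → L) 0 = xs 0 := fun b =>
    Fin.snoc_castSucc (α := fun _ => L) b xs 0
  have h1 : ∀ b : L, (Fin.snoc xs b : Fin 2 → L) 1 = b := fun b =>
    Fin.snoc_last (α := fun _ => L) b xs
  have hbot : ∀ b : L, (∀ c, b ≤ c) ↔ b = ⊥ := fun b =>
    ⟨fun h => le_bot_iff.1 (h ⊥), fun h c => h ▸ bot_le⟩
  simp only [atomFormula, BoundedFormula.realize_inf, BoundedFormula.realize_not,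
    BoundedFormula.realize_all, BoundedFormula.realize_imp, BoundedFormula.realize_sup,
    realize_botFormula, realize_leFormula, bvar, Term.realize_var, Sum.elim_inr, h0, h1, hbot]
  refine and_congr_right fun _ => forall_congr' fun b => ?_
  rw [lt_iff_le_not_ge, and_imp]
  tauto

/-- The formula stating that the bound variable `0` satisfies `IsMonolithOfNonchain`. -/
def monolithFormula : latticeLang.BoundedFormula (Fin 1) 1 :=
  (leFormula (n := 4) (bvar 2) (bvar 1) ⊓ (leFormula (bvar 3) (bvar 1) ⊓
    ((leFormula (bvar 2) (bvar 3)).not ⊓ ((leFormula (bvar 3) (bvar 2)).not ⊓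
      ((leFormula (n := 5) (bvar 4) (bvar 1)).imp
        (botFormula 4 ⊔ leFormula (bvar 0) (bvar 4))).all)))).ex.ex.ex

theorem realize_monolithFormula {L : Type*} [Lattice L] (v : Fin 1 → L) (xs : Fin 1 → L) :
    monolithFormula.Realize v xs ↔ IsMonolithOfNonchain (xs 0) := by
  simp only [monolithFormula, BoundedFormula.realize_inf, BoundedFormula.realize_not,
    BoundedFormula.realize_all, BoundedFormula.realize_imp, BoundedFormula.realize_sup,
    BoundedFormula.realize_ex, realize_botFormula, realize_leFormula, bvar, Term.realize_var,
    Sum.elim_inr]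
  rfl

/-- The formula stating that every atom below the free variable satisfies
`IsMonolithOfNonchain`. -/
def nilFormula : latticeLang.Formula (Fin 1) :=
  BoundedFormula.all (n := 0)
    (atomFormula.imp ((leFormula (bvar 0) (Term.var (Sum.inl 0))).imp monolithFormula))

theorem realize_nilFormula {L : Type*} [Lattice L] [OrderBot L] (v : Fin 1 → L) :
    nilFormula.Realize v ↔ ∀ a : L, IsAtom a → a ≤ v 0 → IsMonolithOfNonchain a := by
  simp only [nilFormula, Formula.Realize, BoundedFormula.realize_all, BoundedFormula.realize_imp,
    realize_atomFormula, realize_monolithFormula, realize_leFormula, bvar, Term.realize_var,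
    Sum.elim_inr, Sum.elim_inl]
  rfl

end Formulas

/-- **Theorem.** The set of all commutative nil-varieties of semigroups is definable in
the lattice **Com**; moreover, a commutative semigroup variety is a nil-variety if and
only if every atom of **Com** contained in it equals the variety `ZM` of null
semigroups. -/
theorem definable_nil_varieties :
    LatDefinable ComVariety {V : ComVariety | IsNilVariety V} ∧
    (∀ V : ComVariety, IsNilVariety V ↔ ∀ A : ComVariety, IsAtom A → A ≤ V → A = ZMvar) := by
  refine ⟨⟨nilFormula, fun V => ?_⟩, fun V => isNilVariety_iff_forall_isAtom⟩
  rw [realize_nilFormula, Set.mem_ofPred_eq, isNilVariety_iff_forall_isAtom]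
  exact forall₂_congr fun A hA => imp_congr_right fun _ => hA.isMonolithOfNonchain_iff
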